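/- Let V be a 2m-dimensional real vector space with a compatible triple (J, Ω, g) as above, and let W be a 2n-dimensional real vector space with a compatible triple (J_N, ω_N, h). Let L : V → W be a linear map satisfying L ∘ J = J_N ∘ L. Then (L*ω_N) ∧ (Ω^{m-1}/(m-1)!) = (|L|²/2) · (Ω^m/m!), where |L|² is the squared Hilbert–Schmidt norm of L with respect to g and h, and L*ω_N denotes the pullback of ω_N along L. -/

import Mathlib

open Module

/-- The wedge product of a `p`-form and a `q`-form on a real vector space,
in the determinant convention. -/
noncomputable def wedgeForm {V : Type} [AddCommGroup V] [Module ℝ V] {p q : ℕ}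
    (α : V [⋀^Fin p]→ₗ[ℝ] ℝ) (β : V [⋀^Fin q]→ₗ[ℝ] ℝ) : V [⋀^Fin (p + q)]→ₗ[ℝ] ℝ :=
  (TensorProduct.lid ℝ ℝ).toLinearMap.compAlternatingMap
    ((α.domCoprod β).domDomCongr finSumFinEquiv)

/-- The `k`-th wedge power of a `2`-form. -/
noncomputable def wpow {V : Type} [AddCommGroup V] [Module ℝ V]
    (ω : V [⋀^Fin 2]→ₗ[ℝ] ℝ) : (k : ℕ) → V [⋀^Fin (2 * k)]→ₗ[ℝ] ℝ
  | 0 => (AlternatingMap.constOfIsEmpty ℝ V (Fin 0) (1 : ℝ)).domDomCongr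
      (finCongr (by omega : (0 : ℕ) = 2 * 0))
  | (k + 1) => (wedgeForm ω (wpow ω k)).domDomCongr
      (finCongr (by omega : 2 + 2 * k = 2 * (k + 1)))

/-- A linear functional, seen as a `1`-form (alternating map on `Fin 1`). -/
noncomputable def oneForm {V : Type} [AddCommGroup V] [Module ℝ V] (ξ : V →ₗ[ℝ] ℝ) :
    V [⋀^Fin 1]→ₗ[ℝ] ℝ :=
  AlternatingMap.ofSubsingleton ℝ V ℝ (0 : Fin 1) ξ


theorem wedge_alt {V : Type} [AddCommGroup V] [Module ℝ V] {p q : ℕ}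
    (a : MultilinearMap ℝ (fun _ : Fin p => V) ℝ) (c : MultilinearMap ℝ (fun _ : Fin q => V) ℝ) :
    wedgeForm (MultilinearMap.alternatization a) (MultilinearMap.alternatization c) =
    MultilinearMap.alternatization
      ((TensorProduct.lid ℝ ℝ).toLinearMap.compMultilinearMap
        ((a.domCoprod c).domDomCongr finSumFinEquiv)) := by
  unfold wedgeForm
  rw [← MultilinearMap.domCoprod_alternization]
  ext v
  rw [LinearMap.compAlternatingMap_apply, AlternatingMap.domDomCongr_apply,
    MultilinearMap.alternatization_apply, MultilinearMap.alternatization_apply, map_sum,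
    ← Equiv.sum_comp (Equiv.permCongr (finSumFinEquiv (m := p) (n := q)))]
  refine Finset.sum_congr rfl fun σ _ => ?_
  rw [Equiv.Perm.sign_permCongr]
  simp only [Units.smul_def, map_zsmul]
  congr 1
  simp [Function.comp_def, Equiv.permCongr_apply]

theorem wedge_smul {V : Type} [AddCommGroup V] [Module ℝ V] {p q : ℕ}
    (r s : ℝ) (a : V [⋀^Fin p]→ₗ[ℝ] ℝ) (c : V [⋀^Fin q]→ₗ[ℝ] ℝ) :
    wedgeForm (r • a) (s • c) = (r * s) • wedgeForm a c := by
  have h : AlternatingMap.domCoprod (r • a) (s • c) = (r * s) • AlternatingMap.domCoprod a c := by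
    rw [← AlternatingMap.domCoprod'_apply, ← AlternatingMap.domCoprod'_apply,
      TensorProduct.smul_tmul_smul, map_smul]
  unfold wedgeForm
  rw [h]
  ext v
  simp

theorem upd_one {V : Type} (x y z : V) : Function.update ![x, y] 1 z = ![x, z] := by
  ext i
  fin_cases i <;> rfl

/-- A two-form as a bilinear map. -/
noncomputable def bil {V : Type} [AddCommGroup V] [Module ℝ V] (α : V [⋀^Fin 2]→ₗ[ℝ] ℝ) :
    V →ₗ[ℝ] V →ₗ[ℝ] ℝ :=
  LinearMap.mk₂ ℝ (fun x y => α ![x, y])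
    (fun x x' y => α.map_vecCons_add ![y] x x')
    (fun c x y => α.map_vecCons_smul ![y] c x)
    (fun x y y' => by
      have := α.map_update_add ![x, y] 1 y y'
      simpa only [upd_one] using this)
    (fun c x y => by
      have := α.map_update_smul ![x, y] 1 c y
      simpa only [upd_one] using this)

theorem bil_apply {V : Type} [AddCommGroup V] [Module ℝ V] (α : V [⋀^Fin 2]→ₗ[ℝ] ℝ) (x y : V) :
    bil α x y = α ![x, y] := rfl

theorem bil_swap {V : Type} [AddCommGroup V] [Module ℝ V] (α : V [⋀^Fin 2]→ₗ[ℝ] ℝ) (x y : V) :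
    bil α x y = - bil α y x := by
  have := α.map_swap ![y, x] (i := 0) (j := 1) (by decide)
  rw [bil_apply, bil_apply, ← this]
  congr 1
  ext i
  fin_cases i <;> simp

/-- even index -/
def e0 {k : ℕ} (i : Fin k) : Fin (2 * k) := ⟨2 * i, by omega⟩
/-- odd index -/
def e1 {k : ℕ} (i : Fin k) : Fin (2 * k) := ⟨2 * i + 1, by omega⟩

theorem e0_inj {k : ℕ} (i j : Fin k) : e0 i = e0 j ↔ i = j := by
  simp only [e0, Fin.ext_iff]; omega
theorem e1_inj {k : ℕ} (i j : Fin k) : e1 i = e1 j ↔ i = j := by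
  simp only [e1, Fin.ext_iff]; omega
theorem e0_ne_e1 {k : ℕ} (i j : Fin k) : e0 i ≠ e1 j := by
  simp only [e0, e1, Ne, Fin.ext_iff]; omega

theorem wedge_step {V : Type} [AddCommGroup V] [Module ℝ V] {k : ℕ}
    (α : V [⋀^Fin 2]→ₗ[ℝ] ℝ) (s : ℝ) (M : MultilinearMap ℝ (fun _ : Fin (2 * k) => V) ℝ)
    (h : 2 + 2 * k = 2 * (k + 1)) :
    ∃ M' : MultilinearMap ℝ (fun _ : Fin (2 * (k + 1)) => V) ℝ,
      (wedgeForm α (s • MultilinearMap.alternatization M)).domDomCongr (finCongr h) =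
        (1 / 2 * s) • MultilinearMap.alternatization M' ∧
      ∀ v, M' v = bil α (v (e0 0)) (v (e1 0)) * M (fun i => v ⟨i + 2, by omega⟩) := by
  have hα : α = (1 / 2 : ℝ) • MultilinearMap.alternatization (α : MultilinearMap ℝ (fun _ : Fin 2 => V) ℝ) := by
    rw [AlternatingMap.coe_alternatization]
    ext v
    simp
  refine ⟨((TensorProduct.lid ℝ ℝ).toLinearMap.compMultilinearMap
        (((α : MultilinearMap ℝ (fun _ : Fin 2 => V) ℝ).domCoprod M).domDomCongr finSumFinEquiv)).domDomCongr
          (finCongr h), ?_, ?_⟩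
  · conv_lhs => rw [hα]
    rw [wedge_smul, wedge_alt]
    ext v
    rw [AlternatingMap.domDomCongr_apply, AlternatingMap.smul_apply, AlternatingMap.smul_apply,
      MultilinearMap.alternatization_apply, MultilinearMap.alternatization_apply,
      ← Equiv.sum_comp (Equiv.permCongr (finCongr h))]
    congr 1
    refine Finset.sum_congr rfl fun σ _ => ?_
    rw [Equiv.Perm.sign_permCongr]
    congr 1
  · intro v
    simp only [MultilinearMap.domDomCongr_apply, LinearMap.compMultilinearMap_apply,
      MultilinearMap.domCoprod_apply, bil_apply]
    simp only [LinearEquiv.coe_coe, TensorProduct.lid_tmul, smul_eq_mul]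
    congr 1
    · show α _ = α _
      congr 1
      ext i
      fin_cases i <;> rfl
    · congr 1
      ext i
      congr 1
      ext
      simp [add_comm]

theorem wpow_eq {V : Type} [AddCommGroup V] [Module ℝ V] (ω : V [⋀^Fin 2]→ₗ[ℝ] ℝ) (k : ℕ) :
    ∃ M : MultilinearMap ℝ (fun _ : Fin (2 * k) => V) ℝ,
      wpow ω k = ((1 / 2 : ℝ) ^ k) • MultilinearMap.alternatization M ∧
      ∀ v, M v = ∏ i : Fin k, bil ω (v (e0 i)) (v (e1 i)) := by
  induction k with
  | zero =>
    refine ⟨(AlternatingMap.constOfIsEmpty ℝ V (Fin 0) (1 : ℝ)).toMultilinearMap, ?_, ?_⟩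
    · ext v
      simp [wpow, MultilinearMap.alternatization_apply]
    · intro v
      simp
  | succ k ih =>
    obtain ⟨M, hM, hM'⟩ := ih
    obtain ⟨M', h1, h2⟩ := wedge_step ω ((1 / 2 : ℝ) ^ k) M (by omega)
    refine ⟨M', ?_, ?_⟩
    · rw [wpow, hM, h1, pow_succ']
    · intro v
      rw [h2, Fin.prod_univ_succ, hM']
      rfl

/-- Expansion -/
noncomputable def T {V : Type} [AddCommGroup V] [Module ℝ V] {k : ℕ}
    (F : Fin k → (V →ₗ[ℝ] V →ₗ[ℝ] ℝ)) (v : Fin (2 * k) → V) : ℝ :=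
  ∑ σ : Equiv.Perm (Fin (2 * k)), Equiv.Perm.sign σ • ∏ i, F i (v (σ (e0 i))) (v (σ (e1 i)))

theorem wpow_T {V : Type} [AddCommGroup V] [Module ℝ V] (ω : V [⋀^Fin 2]→ₗ[ℝ] ℝ) (k : ℕ)
    (v : Fin (2 * k) → V) : wpow ω k v = (1 / 2 : ℝ) ^ k * T (fun _ => bil ω) v := by
  obtain ⟨M, h1, h2⟩ := wpow_eq ω k
  rw [h1, AlternatingMap.smul_apply, MultilinearMap.alternatization_apply, smul_eq_mul, T]
  simp [h2]

theorem wedge_T {V : Type} [AddCommGroup V] [Module ℝ V] (α ω : V [⋀^Fin 2]→ₗ[ℝ] ℝ) (k : ℕ)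
    (h : 2 + 2 * k = 2 * (k + 1))
    (v : Fin (2 * (k + 1)) → V) :
    (wedgeForm α (wpow ω k)).domDomCongr (finCongr h) v =
      (1 / 2 : ℝ) ^ (k + 1) * T (Function.update (fun _ => bil ω) 0 (bil α)) v := by
  obtain ⟨M, h1, h2⟩ := wpow_eq ω k
  obtain ⟨M', h3, h4⟩ := wedge_step α ((1 / 2 : ℝ) ^ k) M h
  rw [h1, h3, AlternatingMap.smul_apply, MultilinearMap.alternatization_apply, smul_eq_mul, T,
    pow_succ']
  congr 1
  refine Finset.sum_congr rfl fun σ _ => ?_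
  rw [MultilinearMap.domDomCongr_apply, h4, h2, Fin.prod_univ_succ]
  simp [Fin.succ_ne_zero, e0, e1, mul_add]

theorem T_swap {V : Type} [AddCommGroup V] [Module ℝ V] {k : ℕ}
    (a c : V →ₗ[ℝ] V →ₗ[ℝ] ℝ) (v : Fin (2 * (k + 1)) → V) (j : Fin (k + 1)) :
    T (Function.update (fun _ => c) j a) v = T (Function.update (fun _ => c) 0 a) v := by
  by_cases hj : j = 0
  · rw [hj]
  have hj' : (j : ℕ) ≠ 0 := fun h => hj (Fin.ext h)
  let π : Equiv.Perm (Fin (2 * (k + 1))) := Equiv.swap (e0 0) (e0 j) * Equiv.swap (e1 0) (e1 j)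
  have hs : Equiv.Perm.sign π = 1 := by
    rw [Equiv.Perm.sign_mul, Equiv.Perm.sign_swap, Equiv.Perm.sign_swap]
    · rfl
    · rw [Ne, e1_inj]; exact fun h => hj h.symm
    · rw [Ne, e0_inj]; exact fun h => hj h.symm
  have h0 : ∀ i, π (e0 i) = e0 (Equiv.swap 0 j i) := by
    intro i
    rw [Equiv.Perm.mul_apply, Equiv.swap_apply_of_ne_of_ne (e0_ne_e1 _ _) (e0_ne_e1 _ _)]
    simp only [Equiv.swap_apply_def, e0_inj]
    split_ifs <;> rfl
  have h1 : ∀ i, π (e1 i) = e1 (Equiv.swap 0 j i) := by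
    intro i
    have hh : Equiv.swap (e1 0) (e1 j) (e1 i) = e1 (Equiv.swap 0 j i) := by
      simp only [Equiv.swap_apply_def, e1_inj]
      split_ifs <;> rfl
    rw [Equiv.Perm.mul_apply, hh,
      Equiv.swap_apply_of_ne_of_ne (e0_ne_e1 _ _).symm (e0_ne_e1 _ _).symm]
  unfold T
  rw [← Equiv.sum_comp (Equiv.mulRight π)]
  refine Finset.sum_congr rfl fun σ _ => ?_
  simp only [Equiv.coe_mulRight, Equiv.Perm.sign_mul, hs, mul_one, Equiv.Perm.mul_apply, h0, h1]
  congr 1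
  rw [← Equiv.prod_comp (Equiv.swap 0 j)]
  refine Finset.prod_congr rfl fun i _ => ?_
  rw [← Equiv.Perm.mul_apply, Equiv.swap_mul_self, Equiv.Perm.one_apply]
  congr 2
  simp only [Function.update_apply, Equiv.swap_apply_def]
  split_ifs <;> simp_all

theorem sum_idx {k : ℕ} (f : Fin (2 * k) → ℝ) : ∑ l, f l = ∑ j : Fin k, (f (e0 j) + f (e1 j)) := by
  induction k with
  | zero => simp
  | succ k ih =>
    rw [Fin.sum_univ_succ (n := k)]
    show ∑ l : Fin (2 * k + 1 + 1), f l = _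
    rw [Fin.sum_univ_succ, Fin.sum_univ_succ, ← add_assoc]
    congr 1
    exact ih (fun l => f l.succ.succ)

theorem key {V : Type} [AddCommGroup V] [Module ℝ V] {k : ℕ}
    (a c : V →ₗ[ℝ] V →ₗ[ℝ] ℝ) (u u' : Fin (2 * k) → V)
    (h0 : ∀ l l', c (u' l) (u l') = a (u l) (u l'))
    (h1 : ∀ l l', c (u l) (u' l') = a (u l) (u l')) :
    ∑ l, ∏ i : Fin k, c (Function.update u l (u' l) (e0 i)) (Function.update u l (u' l) (e1 i)) =
      2 * ∑ j, ∏ i : Fin k, (Function.update (fun _ => c) j a : Fin k → _) i (u (e0 i)) (u (e1 i)) := by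
  rw [sum_idx, Finset.mul_sum]
  refine Finset.sum_congr rfl fun j _ => ?_
  refine Eq.trans ?_ (two_mul _).symm
  congr 1 <;> refine Finset.prod_congr rfl fun i _ => ?_
  · by_cases h : i = j
    · subst h
      rw [Function.update_self, Function.update_of_ne (e0_ne_e1 _ _).symm, Function.update_self, h0]
    · rw [Function.update_of_ne (e0_ne_e1 _ _).symm, Function.update_of_ne (by rwa [Ne, e0_inj]),
        Function.update_of_ne h]
  · by_cases h : i = j
    · subst h
      rw [Function.update_self, Function.update_of_ne (e0_ne_e1 _ _), Function.update_self, h1]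
    · rw [Function.update_of_ne (e0_ne_e1 _ _), Function.update_of_ne (by rwa [Ne, e1_inj]),
        Function.update_of_ne h]

theorem T_deriv {V : Type} [AddCommGroup V] [Module ℝ V] {k : ℕ}
    (a c : V →ₗ[ℝ] V →ₗ[ℝ] ℝ) (u u' : Fin (2 * k) → V)
    (h0 : ∀ l l', c (u' l) (u l') = a (u l) (u l'))
    (h1 : ∀ l l', c (u l) (u' l') = a (u l) (u l')) :
    ∑ l, T (fun _ : Fin k => c) (Function.update u l (u' l)) =
      2 * ∑ j, T (Function.update (fun _ : Fin k => c) j a) u := by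
  unfold T
  rw [Finset.sum_comm, Finset.sum_comm (s := (Finset.univ : Finset (Fin k))), Finset.mul_sum]
  refine Finset.sum_congr rfl fun σ _ => ?_
  rw [← Finset.smul_sum, ← Finset.smul_sum, ← Equiv.sum_comp σ, mul_smul_comm]
  congr 1
  refine Eq.trans ?_ (key a c (u ∘ σ) (u' ∘ σ) (fun _ _ => h0 _ _) (fun _ _ => h1 _ _))
  refine Finset.sum_congr rfl fun l _ => ?_
  refine Finset.prod_congr rfl fun i _ => ?_
  simp [Function.update_apply]

theorem top_deriv {V : Type} [AddCommGroup V] [Module ℝ V] {N : ℕ} (f : V [⋀^Fin N]→ₗ[ℝ] ℝ)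
    (b : Fin N → V) (A : Fin N → Fin N → ℝ) (l : Fin N) :
    f (Function.update b l (∑ i, A l i • b i)) = A l l * f b := by
  rw [f.map_update_sum, Finset.sum_eq_single l]
  · rw [f.map_update_smul, Function.update_eq_self, smul_eq_mul]
  · intro i _ hi
    rw [f.map_update_smul, f.map_update_self _ hi.symm, smul_zero]
  · simp

/-- for linear almost-Kähler structures `(V, J, Ω, g)` (dim `2m`) and
`(W, J_N, ω_N, h)` (dim `2n`) and a complex-linear map `L : V → W`, one has
`L*ω_N ∧ Ω^{m-1}/(m-1)! = (|L|²/2) · Ω^m/m!` where `|L|²` is the squared Hilbert–Schmidt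
norm of `L`, computed via a `g`-orthonormal basis `b` of `V` as `∑ i, h (L (b i)) (L (b i))`
(and `h(w,w) = ω_N(w, J_N w)`). -/
theorem pullback_wedge_identity {m n : ℕ} (hm : 1 ≤ m) {V W : Type}
    [AddCommGroup V] [Module ℝ V] [FiniteDimensional ℝ V]
    [AddCommGroup W] [Module ℝ W] [FiniteDimensional ℝ W]
    (hdimV : Module.finrank ℝ V = 2 * m) (hdimW : Module.finrank ℝ W = 2 * n)
    (J : V →ₗ[ℝ] V) (hJ : J ∘ₗ J = -LinearMap.id)
    (Ω : V [⋀^Fin 2]→ₗ[ℝ] ℝ)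
    (hcompat : ∀ v w : V, Ω ![J v, J w] = Ω ![v, w])
    (hpos : ∀ v : V, v ≠ 0 → 0 < Ω ![v, J v])
    (JN : W →ₗ[ℝ] W) (hJN : JN ∘ₗ JN = -LinearMap.id)
    (ωN : W [⋀^Fin 2]→ₗ[ℝ] ℝ)
    (hcompatN : ∀ v w : W, ωN ![JN v, JN w] = ωN ![v, w])
    (hposN : ∀ w : W, w ≠ 0 → 0 < ωN ![w, JN w])
    (L : V →ₗ[ℝ] W) (hL : ∀ v : V, L (J v) = JN (L v))
    (b : Basis (Fin (2 * m)) ℝ V)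
    (hb : ∀ i j, Ω ![b i, J (b j)] = if i = j then 1 else 0) :
    (((m - 1).factorial : ℝ))⁻¹ •
        ((wedgeForm (ωN.compLinearMap L) (wpow Ω (m - 1))).domDomCongr
          (finCongr (by omega : 2 + 2 * (m - 1) = 2 * m)))
      = ((∑ i, ωN ![L (b i), JN (L (b i))]) / 2 * ((m.factorial : ℝ))⁻¹) • wpow Ω m := by
  obtain ⟨k, rfl⟩ : ∃ k, m = k + 1 := ⟨m - 1, by omega⟩
  simp only [Nat.add_sub_cancel]
  set α := ωN.compLinearMap L with hα
  have hαJ : ∀ i, ωN ![L (b i), JN (L (b i))] = bil α (b i) (J (b i)) := by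
    intro i
    rw [bil_apply, hα, AlternatingMap.compLinearMap_apply, ← hL]
    congr 1
    ext i
    fin_cases i <;> rfl
  simp only [hαJ]
  have hJJ : ∀ v, J (J v) = -v := fun v => by
    have := LinearMap.congr_fun hJ v
    simpa using this
  set u' : Fin (2 * (k + 1)) → V := fun l => ∑ i, bil α (b l) (J (b i)) • b i with hu'
  have h0 : ∀ l l', bil Ω (u' l) (b l') = bil α (b l) (b l') := by
    intro l l'
    have : (bil Ω (u' l)) ∘ₗ J = (bil α (b l)) ∘ₗ J := by
      refine b.ext fun j => ?_
      simp only [hu', LinearMap.comp_apply, map_sum, map_smul, LinearMap.sum_apply,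
        LinearMap.smul_apply]
      simp [bil_apply, hb]
    have := LinearMap.congr_fun this (J (b l'))
    simpa [hJJ] using this
  have h1 : ∀ l l', bil Ω (b l) (u' l') = bil α (b l) (b l') := by
    intro l l'
    rw [bil_swap, h0, ← bil_swap]
  have hT := T_deriv (bil α) (bil Ω) b u' h0 h1
  simp only [T_swap] at hT
  have hD : ∀ l, wpow Ω (k + 1) (Function.update b l (u' l)) =
      bil α (b l) (J (b l)) * wpow Ω (k + 1) b := fun l =>
    top_deriv (wpow Ω (k + 1)) b (fun l i => bil α (b l) (J (b i))) l
  have hS := Finset.sum_congr (rfl : (Finset.univ : Finset (Fin (2 * (k + 1)))) = Finset.univ)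
    (fun l _ => hD l)
  rw [← Finset.sum_mul] at hS
  simp only [wpow_T] at hS
  rw [← Finset.mul_sum, hT] at hS
  rw [AlternatingMap.eq_smul_basis_det b (_ • AlternatingMap.domDomCongr _ _),
    AlternatingMap.eq_smul_basis_det b (_ • wpow Ω (k + 1))]
  congr 1
  rw [AlternatingMap.smul_apply, AlternatingMap.smul_apply, wedge_T, wpow_T, smul_eq_mul,
    smul_eq_mul, mul_right_comm, div_mul_eq_mul_div, ← hS]
  have hk : ((k + 1 : ℕ) : ℝ) ≠ 0 := by positivity
  have hk' : ((k).factorial : ℝ) ≠ 0 := by positivity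
  rw [Nat.factorial_succ]
  push_cast at hk ⊢
  simp
  field_simp
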